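/- arXiv:2406.01336 — 4 statements merged into one kernel-verified Lean document; each statement's English description precedes it below -/
import Mathlib

section
/- Let F be a field, K an algebraically closed field extension of F, and I an ideal of F[x₁,…,xₙ]. If p ∈ F[x₁,…,xₙ] vanishes on 𝕍(I), i.e. p(x̄) = 0 (evaluating coefficients via the inclusion F ↪ K) for every x̄ ∈ 𝕍(I), then p^r ∈ I for some integer r ≥ 1. -/
/-- Hilbert's Nullstellensatz: if `p ∈ F[x₁,…,xₙ]` vanishes on the variety `𝕍(I) ⊆ Kⁿ`
(`K` an algebraically closed extension of `F`), then `p^r ∈ I` for some `r ≥ 1`. -/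
theorem nullstellensatz (F K : Type*) [Field F] [Field K] [Algebra F K] [IsAlgClosed K]
    (n : ℕ) (I : Ideal (MvPolynomial (Fin n) F)) (p : MvPolynomial (Fin n) F)
    (h : ∀ x : Fin n → K, (∀ f ∈ I, MvPolynomial.aeval x f = 0) →
      MvPolynomial.aeval x p = 0) :
    ∃ r : ℕ, 1 ≤ r ∧ p ^ r ∈ I := by
  have hp : p ∈ MvPolynomial.vanishingIdeal F (MvPolynomial.zeroLocus K I) :=
    fun x hx => h x hx
  rw [MvPolynomial.vanishingIdeal_zeroLocus_eq_radical] at hp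
  obtain ⟨r, hr⟩ := hp
  exact ⟨r + 1, Nat.le_add_left 1 r, by rw [pow_succ]; exact I.mul_mem_right p hr⟩
end

section
/- Let F be a field, K an algebraically closed field extension of F, and I an ideal of F[x₁,…,xₙ]. Then 1 ∈ I if and only if the polynomials in I have no common zero in Kⁿ, i.e. 𝕍(I) = ∅. -/
/-- Weak Nullstellensatz: `1 ∈ I` iff the polynomials of `I` have no common zero
in `Kⁿ`, where `K` is an algebraically closed extension of `F`. -/
theorem weak_nullstellensatz (F K : Type*) [Field F] [Field K] [Algebra F K] [IsAlgClosed K]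
    (n : ℕ) (I : Ideal (MvPolynomial (Fin n) F)) :
    (1 : MvPolynomial (Fin n) F) ∈ I ↔
      {x : Fin n → K | ∀ f ∈ I, MvPolynomial.aeval x f = 0} = ∅ := by
  constructor
  · intro h
    ext x
    simp only [Set.mem_setOf_eq, Set.mem_empty_iff_false, iff_false]
    intro hx
    have h1 := hx 1 h
    simp at h1
  · intro h
    by_contra h1
    obtain ⟨M, hM, hIM⟩ := Ideal.exists_le_maximal I ((Ideal.ne_top_iff_one I).2 h1)
    obtain ⟨x, hx⟩ := MvPolynomial.eq_vanishingIdeal_singleton_of_isMaximal K hM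
    have : x ∈ {x : Fin n → K | ∀ f ∈ I, MvPolynomial.aeval x f = 0} := by
      intro f hf
      have h2 := hIM hf
      rw [hx] at h2
      exact (MvPolynomial.mem_vanishingIdeal_singleton_iff x f).1 h2
    rw [h] at this
    exact this
end

section
/- Let F be a field and K an algebraically closed field extension of F. If I is a proper ideal of F[x₁,…,xₙ], then 𝕍(I) ≠ ∅, i.e. there exists a common zero in Kⁿ of all polynomials in I. -/
/-- Weak Nullstellensatz (proper-ideal form): if `I` is a proper ideal of `F[x₁,…,xₙ]`,
then the polynomials of `I` have a common zero in `Kⁿ`, for `K` an algebraically closed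
extension of `F`. -/
theorem weak_nullstellensatz_proper (F K : Type*) [Field F] [Field K] [Algebra F K]
    [IsAlgClosed K] (n : ℕ) (I : Ideal (MvPolynomial (Fin n) F)) (hI : I ≠ ⊤) :
    {x : Fin n → K | ∀ f ∈ I, MvPolynomial.aeval x f = 0} ≠ ∅ := by
  obtain ⟨M, hM, hIM⟩ := Ideal.exists_le_maximal I hI
  obtain ⟨x, hx⟩ := MvPolynomial.eq_vanishingIdeal_singleton_of_isMaximal K hM
  refine Set.Nonempty.ne_empty ⟨x, fun f hf => ?_⟩
  have h := hIM hf
  rw [hx] at h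
  exact (MvPolynomial.mem_vanishingIdeal_singleton_iff x f).1 h
end

section
/- Let F be a field, K an algebraically closed field extension of F, and g, f₁,…,fₘ ∈ F[x₁,…,xₙ]. Then g vanishes on 𝕍({f₁,…,fₘ}) ⊆ Kⁿ if and only if there exists an integer r ≥ 1 such that g^r ∈ ⟨f₁,…,fₘ⟩, the ideal of F[x₁,…,xₙ] generated by f₁,…,fₘ. -/
/-- `g` vanishes on `𝕍({f₁,…,fₘ}) ⊆ Kⁿ` iff `g^r ∈ ⟨f₁,…,fₘ⟩` for some `r ≥ 1`,
where `K` is an algebraically closed extension of `F`. -/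
theorem vanishes_iff_pow_mem (F K : Type*) [Field F] [Field K] [Algebra F K] [IsAlgClosed K]
    (n m : ℕ) (g : MvPolynomial (Fin n) F) (f : Fin m → MvPolynomial (Fin n) F) :
    (∀ x : Fin n → K, (∀ i, MvPolynomial.aeval x (f i) = 0) →
        MvPolynomial.aeval x g = 0) ↔
      ∃ r : ℕ, 1 ≤ r ∧ g ^ r ∈ Ideal.span (Set.range f) := by
  have h := congrArg (fun I => g ∈ I)
    (MvPolynomial.vanishingIdeal_zeroLocus_eq_radical (K := K) (Ideal.span (Set.range f)))
  simp only [MvPolynomial.mem_vanishingIdeal_iff, MvPolynomial.zeroLocus_span,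
    Set.mem_setOf_eq, Set.forall_mem_range, eq_iff_iff] at h
  rw [h, Ideal.mem_radical_iff]
  constructor
  · rintro ⟨r, hr⟩
    exact ⟨r + 1, by omega, by rw [pow_succ]; exact Ideal.mul_mem_right _ _ hr⟩
  · rintro ⟨r, _, hr⟩
    exact ⟨r, hr⟩
end
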